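/- Let v : ℝ³ → ℝ³ be C^∞ with |v(x)| = 1 for all x, satisfying the harmonic map equation −Δv − |∇v|² v = 0 on ℝ³ (componentwise). If sup_{R ≥ 1} ∫_{C(R/2,R)} |∇v|² dx < +∞, then ∇v ≡ 0, i.e. v is a constant unit vector. -/

import Mathlib

open MeasureTheory Filter Metric Real

noncomputable section

/-- Three-dimensional Euclidean space. -/
abbrev E3 : Type := EuclideanSpace ℝ (Fin 3)

/-- Partial derivative `∂_j f` of a scalar field. -/
def pd (j : Fin 3) (f : E3 → ℝ) (x : E3) : ℝ :=
  fderiv ℝ f x (EuclideanSpace.single j 1)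

/-- Laplacian of a scalar field. -/
def lap (f : E3 → ℝ) (x : E3) : ℝ := ∑ j, pd j (pd j f) x

/-- `|∇v|² = Σ_{i,k} (∂_i v_k)²`. -/
def gradSq (v : E3 → Fin 3 → ℝ) (x : E3) : ℝ :=
  ∑ i, ∑ k, (pd i (fun y => v y k) x) ^ 2

/-- The annulus `C(R/2, R)`. -/
def ann (R : ℝ) : Set E3 := {x : E3 | R / 2 < ‖x‖ ∧ ‖x‖ < R}

section PartialDerivatives

variable {f g : E3 → ℝ}

theorem pd_add (hf : Differentiable ℝ f) (hg : Differentiable ℝ g) (j : Fin 3) (x : E3) :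
    pd j (fun y => f y + g y) x = pd j f x + pd j g x := by
  simp [pd, fderiv_fun_add (hf x) (hg x)]

theorem pd_sub (hf : Differentiable ℝ f) (hg : Differentiable ℝ g) (j : Fin 3) (x : E3) :
    pd j (fun y => f y - g y) x = pd j f x - pd j g x := by
  simp [pd, fderiv_fun_sub (hf x) (hg x)]

theorem pd_mul (hf : Differentiable ℝ f) (hg : Differentiable ℝ g) (j : Fin 3) (x : E3) :
    pd j (fun y => f y * g y) x = pd j f x * g x + f x * pd j g x := by
  simp [pd, fderiv_fun_mul (hf x) (hg x)]
  ring

theorem pd_const_mul (hf : Differentiable ℝ f) (c : ℝ) (j : Fin 3) (x : E3) :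
    pd j (fun y => c * f y) x = c * pd j f x := by
  simp [pd, fderiv_const_mul (hf x)]

theorem pd_sq (hf : Differentiable ℝ f) (j : Fin 3) (x : E3) :
    pd j (fun y => f y ^ 2) x = 2 * f x * pd j f x := by
  simp only [pow_two]
  rw [pd_mul hf hf]
  ring

theorem pd_sum {F : Fin 3 → E3 → ℝ} (hF : ∀ i, Differentiable ℝ (F i)) (j : Fin 3) (x : E3) :
    pd j (fun y => ∑ i, F i y) x = ∑ i, pd j (F i) x := by
  simp [pd, fderiv_fun_sum (fun i _ => hF i x)]

theorem pd_coord (i j : Fin 3) (x : E3) :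
    pd i (fun y => y j) x = if i = j then 1 else 0 := by
  have h : HasFDerivAt (fun y : E3 => y j) (EuclideanSpace.proj j : E3 →L[ℝ] ℝ) x :=
    (EuclideanSpace.proj j : E3 →L[ℝ] ℝ).hasFDerivAt
  simp [pd, h.fderiv, eq_comm]

theorem contDiff_pd (hf : ContDiff ℝ (⊤ : ℕ∞) f) (j : Fin 3) :
    ContDiff ℝ (⊤ : ℕ∞) (pd j f) :=
  (hf.fderiv_right (by simp)).clm_apply contDiff_const

theorem pd_comm (hf : ContDiff ℝ (⊤ : ℕ∞) f) (i j : Fin 3) (x : E3) :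
    pd i (pd j f) x = pd j (pd i f) x := by
  have hd : DifferentiableAt ℝ (fderiv ℝ f) x :=
    ((hf.fderiv_right (m := (⊤ : ℕ∞)) (by simp)).differentiable (by simp)) x
  have h (a b : Fin 3) : pd a (pd b f) x =
      fderiv ℝ (fderiv ℝ f) x (EuclideanSpace.single a 1) (EuclideanSpace.single b 1) := by
    change fderiv ℝ (fun y => fderiv ℝ f y (EuclideanSpace.single b 1)) x _ = _
    rw [fderiv_clm_apply hd (differentiableAt_const _)]
    simp
  rw [h, h]
  refine (hf.contDiffAt (x := x)).isSymmSndFDerivAt ?_ _ _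
  simp only [minSmoothness_of_isRCLikeNormedField]
  exact WithTop.coe_le_coe.2 (le_top : (2 : ℕ∞) ≤ ⊤)

theorem integral_pd_eq_zero (hf : ContDiff ℝ (⊤ : ℕ∞) f) (hc : HasCompactSupport f) (j : Fin 3) :
    ∫ x, pd j f x = 0 := by
  have hi : Integrable (pd j f) :=
    (contDiff_pd hf j).continuous.integrable_of_hasCompactSupport (hc.fderiv_apply ℝ _)
  have h := integral_mul_fderiv_eq_neg_fderiv_mul_of_integrable (μ := (volume : Measure E3))
    (f := fun _ => (1 : ℝ)) (g := f) (v := EuclideanSpace.single j 1)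
    (by simp) (by simpa [pd] using! hi)
    (by simpa using hf.continuous.integrable_of_hasCompactSupport hc)
    (fun x _ => differentiableAt_const _) (fun x _ => (hf.differentiable (by simp)) x)
  simpa [pd] using h

end PartialDerivatives

section StressEnergy

variable {v : E3 → Fin 3 → ℝ}

/-- The radial derivative `x · ∇v_k`. -/
def radialDeriv (v : E3 → Fin 3 → ℝ) (k : Fin 3) (x : E3) : ℝ :=
  ∑ j, x j * pd j (fun y => v y k) x

/-- The stress-energy tensor of `v` contracted with the position vector field. -/
def radialStress (v : E3 → Fin 3 → ℝ) (i : Fin 3) (x : E3) : ℝ :=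
  gradSq v x * x i - 2 * ∑ k, pd i (fun y => v y k) x * radialDeriv v k x

theorem gradSq_nonneg (v : E3 → Fin 3 → ℝ) (x : E3) : 0 ≤ gradSq v x := by
  unfold gradSq
  positivity

theorem contDiff_coord (i : Fin 3) : ContDiff ℝ (⊤ : ℕ∞) (fun y : E3 => y i) :=
  (EuclideanSpace.proj i : E3 →L[ℝ] ℝ).contDiff

theorem contDiff_gradSq (hv : ContDiff ℝ (⊤ : ℕ∞) v) : ContDiff ℝ (⊤ : ℕ∞) (gradSq v) :=
  ContDiff.sum fun i _ => ContDiff.sum fun k _ => (contDiff_pd (contDiff_pi.1 hv k) i).pow 2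

theorem contDiff_radialDeriv (hv : ContDiff ℝ (⊤ : ℕ∞) v) (k : Fin 3) :
    ContDiff ℝ (⊤ : ℕ∞) (radialDeriv v k) :=
  ContDiff.sum fun j _ => (contDiff_coord j).mul (contDiff_pd (contDiff_pi.1 hv k) j)

theorem contDiff_radialStress (hv : ContDiff ℝ (⊤ : ℕ∞) v) (i : Fin 3) :
    ContDiff ℝ (⊤ : ℕ∞) (radialStress v i) :=
  ((contDiff_gradSq hv).mul (contDiff_coord i)).sub (contDiff_const.mul (ContDiff.sum fun k _ =>
    (contDiff_pd (contDiff_pi.1 hv k) i).mul (contDiff_radialDeriv hv k)))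

theorem sum_mul_pd_eq_zero (hv : ContDiff ℝ (⊤ : ℕ∞) v)
    (hunit : ∀ x : E3, ∑ i, (v x i) ^ 2 = 1) (j : Fin 3) (x : E3) :
    ∑ k, v x k * pd j (fun y => v y k) x = 0 := by
  have hd (k : Fin 3) : Differentiable ℝ (fun y => v y k) :=
    (contDiff_pi.1 hv k).differentiable (by simp)
  have h : pd j (fun y => ∑ k, v y k ^ 2) x = 0 := by
    simp only [hunit]
    simp [pd]
  rw [pd_sum (fun k => (hd k).fun_pow 2)] at h
  simp only [pd_sq (hd _), mul_assoc, ← Finset.mul_sum] at h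
  simpa using h

theorem sum_pd_radialStress (hv : ContDiff ℝ (⊤ : ℕ∞) v)
    (hunit : ∀ x : E3, ∑ i, (v x i) ^ 2 = 1)
    (heq : ∀ x : E3, ∀ i : Fin 3, -(lap (fun y => v y i) x) - gradSq v x * v x i = 0) (x : E3) :
    ∑ i, pd i (radialStress v i) x = gradSq v x := by
  have hA (i k : Fin 3) : Differentiable ℝ (pd i (fun y => v y k)) :=
    (contDiff_pd (contDiff_pi.1 hv k) i).differentiable (by simp)
  have hX (i : Fin 3) : Differentiable ℝ (fun y : E3 => y i) :=
    (contDiff_coord i).differentiable (by simp)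
  have hD (k : Fin 3) : Differentiable ℝ (radialDeriv v k) :=
    (contDiff_radialDeriv hv k).differentiable (by simp)
  have hG : Differentiable ℝ (gradSq v) := (contDiff_gradSq hv).differentiable (by simp)
  have hpdD (i k : Fin 3) : pd i (radialDeriv v k) x =
      pd i (fun y => v y k) x + ∑ j, x j * pd j (pd i (fun y => v y k)) x := by
    unfold radialDeriv
    rw [pd_sum (fun j => (hX j).fun_mul (hA j k))]
    simp only [pd_mul (hX _) (hA _ _), pd_coord, Finset.sum_add_distrib, ite_mul, one_mul,
      zero_mul, Finset.sum_ite_eq, Finset.mem_univ, if_true,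
      pd_comm (contDiff_pi.1 hv k) i]
  have hpdG (i : Fin 3) : pd i (gradSq v) x =
      ∑ j, ∑ k, 2 * pd j (fun y => v y k) x * pd i (pd j (fun y => v y k)) x := by
    unfold gradSq
    rw [pd_sum (fun j => Differentiable.fun_sum fun k _ => (hA j k).fun_pow 2)]
    refine Finset.sum_congr rfl fun j _ => ?_
    rw [pd_sum (fun k => (hA j k).fun_pow 2)]
    simp only [pd_sq (hA _ _)]
  have hpdS (i : Fin 3) : pd i (radialStress v i) x =
      (∑ j, ∑ k, 2 * pd j (fun y => v y k) x * pd i (pd j (fun y => v y k)) x) * x i + gradSq v x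
      - 2 * ∑ k, (pd i (pd i (fun y => v y k)) x * radialDeriv v k x
        + pd i (fun y => v y k) x *
          (pd i (fun y => v y k) x + ∑ j, x j * pd j (pd i (fun y => v y k)) x)) := by
    unfold radialStress
    rw [pd_sub (hG.fun_mul (hX i))
      ((Differentiable.fun_sum fun k _ => (hA i k).fun_mul (hD k)).const_mul 2),
      pd_mul hG (hX i), pd_const_mul (Differentiable.fun_sum fun k _ => (hA i k).fun_mul (hD k)),
      pd_sum fun k => (hA i k).fun_mul (hD k)]
    simp only [pd_mul (hA _ _) (hD _), hpdD, hpdG, pd_coord, if_true, mul_one]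
  have hlap (k : Fin 3) : ∑ i, pd i (pd i (fun y => v y k)) x = - gradSq v x * v x k := by
    have := heq x k
    unfold lap at this
    linarith
  have horth : ∑ k, v x k * radialDeriv v k x = 0 := by
    simp only [radialDeriv, Finset.mul_sum]
    rw [Finset.sum_comm]
    refine Finset.sum_eq_zero fun j _ => ?_
    simp only [mul_left_comm _ (x j), ← Finset.mul_sum, sum_mul_pd_eq_zero hv hunit, mul_zero]
  have hlapD : ∑ i, ∑ k, pd i (pd i (fun y => v y k)) x * radialDeriv v k x = 0 := by
    rw [Finset.sum_comm]
    simp only [← Finset.sum_mul, hlap, mul_assoc, ← Finset.mul_sum, horth, mul_zero]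
  have hcross : ∑ i, (∑ j, ∑ k, 2 * pd j (fun y => v y k) x * pd i (pd j (fun y => v y k)) x) * x i
      = 2 * ∑ i, ∑ k, pd i (fun y => v y k) x * ∑ j, x j * pd j (pd i (fun y => v y k)) x := by
    simp only [Finset.sum_mul, Finset.mul_sum]
    rw [Finset.sum_comm]
    refine Finset.sum_congr rfl fun i _ => ?_
    rw [Finset.sum_comm]
    refine Finset.sum_congr rfl fun k _ => Finset.sum_congr rfl fun j _ => by ring
  have hgrad : ∑ i, ∑ k, pd i (fun y => v y k) x * pd i (fun y => v y k) x = gradSq v x := by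
    simp only [gradSq, pow_two]
  simp only [hpdS, Finset.sum_sub_distrib, Finset.sum_add_distrib, mul_add, ← Finset.mul_sum]
  rw [hcross, hlapD, hgrad]
  simp
  ring

theorem sum_radialStress_mul_coord (v : E3 → Fin 3 → ℝ) (x : E3) :
    ∑ i, radialStress v i x * x i = gradSq v x * ‖x‖ ^ 2 - 2 * ∑ k, radialDeriv v k x ^ 2 := by
  have h : ‖x‖ ^ 2 = ∑ i, x i ^ 2 := by simp [EuclideanSpace.norm_sq_eq]
  rw [h]
  simp only [radialStress, radialDeriv, Fin.sum_univ_three]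
  ring

end StressEnergy

section Monotonicity

variable {v : E3 → Fin 3 → ℝ}

theorem deriv_smoothTransition_of_nonpos {t : ℝ} (ht : t ≤ 0) : deriv smoothTransition t = 0 := by
  refine IsLocalMin.deriv_eq_zero (Eventually.of_forall fun s => ?_)
  rw [smoothTransition.zero_of_nonpos ht]
  exact smoothTransition.nonneg s

theorem deriv_smoothTransition_of_one_le {t : ℝ} (ht : 1 ≤ t) :
    deriv smoothTransition t = 0 := by
  refine IsLocalMax.deriv_eq_zero (Eventually.of_forall fun s => ?_)
  rw [smoothTransition.one_of_one_le ht]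
  exact smoothTransition.le_one s

theorem exists_deriv_smoothTransition_le : ∃ K : ℝ, 0 < K ∧
    ∀ t, deriv smoothTransition t ≤ K := by
  have hc : Continuous (deriv smoothTransition) :=
    (smoothTransition.contDiff (n := 1)).continuous_deriv (by simp)
  obtain ⟨K, hK⟩ := (isCompact_Icc (a := (0 : ℝ)) (b := 1)).exists_bound_of_continuousOn
    hc.continuousOn
  refine ⟨max K 1, by positivity, fun t => ?_⟩
  by_cases ht : t ∈ Set.Icc (0 : ℝ) 1
  · exact (le_abs_self _).trans ((hK t ht).trans (le_max_left _ _))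
  · suffices h : deriv smoothTransition t = 0 by rw [h]; positivity
    rw [Set.mem_Icc, not_and_or, not_le, not_le] at ht
    rcases ht with ht | ht
    · exact deriv_smoothTransition_of_nonpos ht.le
    · exact deriv_smoothTransition_of_one_le ht.le

/-- A smooth radial cutoff, equal to `1` for `|x| ≤ R/2` and to `0` for `|x| ≥ R`. -/
def radialCutoff (R : ℝ) (x : E3) : ℝ :=
  smoothTransition (4 / 3 * (1 - ‖x‖ ^ 2 / R ^ 2))

theorem contDiff_radialCutoff (R : ℝ) : ContDiff ℝ (⊤ : ℕ∞) (radialCutoff R) :=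
  smoothTransition.contDiff.comp
    (contDiff_const.mul (contDiff_const.sub ((contDiff_norm_sq ℝ).div_const _)))

theorem hasCompactSupport_radialCutoff {R : ℝ} (hR : 0 < R) :
    HasCompactSupport (radialCutoff R) := by
  refine HasCompactSupport.intro (isCompact_closedBall (0 : E3) R) fun x hx => ?_
  rw [mem_closedBall_zero_iff, not_le] at hx
  refine smoothTransition.zero_of_nonpos ?_
  have : 1 ≤ ‖x‖ ^ 2 / R ^ 2 := by
    rw [one_le_div (by positivity)]
    gcongr
  linarith

theorem pd_radialCutoff (R : ℝ) (i : Fin 3) (x : E3) :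
    pd i (radialCutoff R) x =
      -(8 / 3 / R ^ 2 * deriv smoothTransition (4 / 3 * (1 - ‖x‖ ^ 2 / R ^ 2))) * x i := by
  have h1 : HasFDerivAt (fun y : E3 => ‖y‖ ^ 2) (2 • innerSL ℝ x) x :=
    (hasStrictFDerivAt_norm_sq x).hasFDerivAt
  have h2 : HasFDerivAt (fun y : E3 => 4 / 3 * (1 - ‖y‖ ^ 2 / R ^ 2))
      ((4 / 3 : ℝ) • -((R ^ 2)⁻¹ • (2 • innerSL ℝ x : E3 →L[ℝ] ℝ))) x := by
    simp only [div_eq_mul_inv _ (R ^ 2)]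
    exact ((h1.mul_const _).const_sub 1).const_mul _
  have h3 := (((smoothTransition.contDiff (n := 1)).differentiable (by simp)
    (4 / 3 * (1 - ‖x‖ ^ 2 / R ^ 2))).hasDerivAt).comp_hasFDerivAt x h2
  unfold pd
  rw [show radialCutoff R = smoothTransition ∘ fun y : E3 => 4 / 3 * (1 - ‖y‖ ^ 2 / R ^ 2)
    from rfl, h3.fderiv]
  simp [EuclideanSpace.inner_single_right]
  ring

theorem integral_stress_identity (hv : ContDiff ℝ (⊤ : ℕ∞) v)
    (hunit : ∀ x : E3, ∑ i, (v x i) ^ 2 = 1)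
    (heq : ∀ x : E3, ∀ i : Fin 3, -(lap (fun y => v y i) x) - gradSq v x * v x i = 0)
    {φ : E3 → ℝ} (hφ : ContDiff ℝ (⊤ : ℕ∞) φ) (hc : HasCompactSupport φ) :
    Integrable (fun x => gradSq v x * φ x + ∑ i, radialStress v i x * pd i φ x) ∧
    ∫ x, (gradSq v x * φ x + ∑ i, radialStress v i x * pd i φ x) = 0 := by
  have hS (i : Fin 3) := contDiff_radialStress hv i
  have hprod (i : Fin 3) : ContDiff ℝ (⊤ : ℕ∞) (fun x => radialStress v i x * φ x) :=
    (hS i).mul hφ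
  have hcs (i : Fin 3) : HasCompactSupport (fun x => radialStress v i x * φ x) := hc.mul_left
  have hpt : (fun x => gradSq v x * φ x + ∑ i, radialStress v i x * pd i φ x) =
      fun x => ∑ i, pd i (fun y => radialStress v i y * φ y) x := by
    funext x
    simp only [pd_mul ((hS _).differentiable (by simp)) (hφ.differentiable (by simp)),
      Finset.sum_add_distrib, ← Finset.sum_mul, sum_pd_radialStress hv hunit heq]
  have hi (i : Fin 3) : Integrable (pd i (fun y => radialStress v i y * φ y)) :=
    (contDiff_pd (hprod i) i).continuous.integrable_of_hasCompactSupport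
      ((hcs i).fderiv_apply ℝ _)
  rw [hpt]
  refine ⟨integrable_finsetSum _ fun i _ => hi i, ?_⟩
  rw [integral_finsetSum _ fun i _ => hi i]
  exact Finset.sum_eq_zero fun i _ => integral_pd_eq_zero (hprod i) (hcs i) i

theorem measurableSet_ann (R : ℝ) : MeasurableSet (ann R) :=
  (measurableSet_lt measurable_const measurable_norm).inter
    (measurableSet_lt measurable_norm measurable_const)

theorem integrableOn_gradSq_closedBall (hv : ContDiff ℝ (⊤ : ℕ∞) v) (R : ℝ) :
    IntegrableOn (gradSq v) (closedBall 0 R) :=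
  (contDiff_gradSq hv).continuous.continuousOn.integrableOn_compact (isCompact_closedBall 0 R)

theorem ann_subset_closedBall (R : ℝ) : ann R ⊆ closedBall 0 R :=
  fun _ hx => mem_closedBall_zero_iff.2 hx.2.le

theorem stress_integrand_lower_bound {K : ℝ} (hK : ∀ t, deriv smoothTransition t ≤ K)
    {R : ℝ} (hR : 0 < R) (v : E3 → Fin 3 → ℝ) (x : E3) :
    (closedBall (0 : E3) (R / 2)).indicator (gradSq v) x
        - 8 / 3 * K * (ann R).indicator (gradSq v) x ≤
      gradSq v x * radialCutoff R x + ∑ i, radialStress v i x * pd i (radialCutoff R) x := by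
  have he := gradSq_nonneg v x
  set t := 4 / 3 * (1 - ‖x‖ ^ 2 / R ^ 2) with ht
  have hd0 : 0 ≤ deriv smoothTransition t := smoothTransition.monotone.deriv_nonneg
  have hsum : ∑ i, radialStress v i x * pd i (radialCutoff R) x =
      8 / 3 / R ^ 2 * deriv smoothTransition t *
        (2 * ∑ k, radialDeriv v k x ^ 2 - gradSq v x * ‖x‖ ^ 2) := by
    rw [← neg_sub, ← sum_radialStress_mul_coord, mul_neg, Finset.mul_sum,
      ← Finset.sum_neg_distrib]
    refine Finset.sum_congr rfl fun i _ => ?_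
    rw [pd_radialCutoff]
    ring
  rw [hsum]
  have hφ : 0 ≤ gradSq v x * radialCutoff R x := mul_nonneg he (smoothTransition.nonneg _)
  rcases le_or_gt ‖x‖ (R / 2) with h1 | h1
  · have ht1 : 1 ≤ t := by
      have : ‖x‖ ^ 2 / R ^ 2 ≤ 1 / 4 := by
        rw [div_le_iff₀ (by positivity)]
        nlinarith [norm_nonneg x]
      linarith
    have hA : x ∉ ann R := fun h => absurd h.1 h1.not_gt
    rw [Set.indicator_of_mem (mem_closedBall_zero_iff.2 h1), Set.indicator_of_notMem hA,
      deriv_smoothTransition_of_one_le ht1, radialCutoff, ← ht,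
      smoothTransition.one_of_one_le ht1]
    simp
  · have hB : x ∉ closedBall (0 : E3) (R / 2) := by
      rwa [mem_closedBall_zero_iff, not_le]
    rw [Set.indicator_of_notMem hB]
    rcases lt_or_ge ‖x‖ R with h2 | h2
    · rw [Set.indicator_of_mem (show x ∈ ann R from ⟨h1, h2⟩)]
      have hr : ‖x‖ ^ 2 / R ^ 2 ≤ 1 := by
        rw [div_le_one (by positivity)]
        gcongr
      have hr0 : 0 ≤ ‖x‖ ^ 2 / R ^ 2 := by positivity
      have hb : deriv smoothTransition t * (‖x‖ ^ 2 / R ^ 2) ≤ K * 1 :=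
        mul_le_mul (hK t) hr hr0 (hd0.trans (hK t))
      have hb' := mul_le_mul_of_nonneg_left hb he
      have hD : 0 ≤ 8 / 3 / R ^ 2 * deriv smoothTransition t *
          (2 * ∑ k, radialDeriv v k x ^ 2) := by positivity
      have hsplit : 8 / 3 / R ^ 2 * deriv smoothTransition t *
          (2 * ∑ k, radialDeriv v k x ^ 2 - gradSq v x * ‖x‖ ^ 2) =
          8 / 3 / R ^ 2 * deriv smoothTransition t * (2 * ∑ k, radialDeriv v k x ^ 2)
          - 8 / 3 * (gradSq v x * (deriv smoothTransition t * (‖x‖ ^ 2 / R ^ 2))) := by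
        ring
      linarith
    · have ht0 : t ≤ 0 := by
        have : 1 ≤ ‖x‖ ^ 2 / R ^ 2 := by
          rw [one_le_div (by positivity)]
          gcongr
        linarith
      have hA : x ∉ ann R := fun h => absurd h.2 h2.not_gt
      rw [Set.indicator_of_notMem hA, deriv_smoothTransition_of_nonpos ht0]
      simpa using hφ

theorem exists_ball_energy_le_annulus_energy (hv : ContDiff ℝ (⊤ : ℕ∞) v)
    (hunit : ∀ x : E3, ∑ i, (v x i) ^ 2 = 1)
    (heq : ∀ x : E3, ∀ i : Fin 3, -(lap (fun y => v y i) x) - gradSq v x * v x i = 0) :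
    ∃ c : ℝ, 0 < c ∧ ∀ R : ℝ, 0 < R →
      ∫ x in closedBall 0 (R / 2), gradSq v x ≤ c * ∫ x in ann R, gradSq v x := by
  obtain ⟨K, hK0, hK⟩ := exists_deriv_smoothTransition_le
  refine ⟨8 / 3 * K, by positivity, fun R hR => ?_⟩
  obtain ⟨hi, h0⟩ := integral_stress_identity hv hunit heq (contDiff_radialCutoff R)
    (hasCompactSupport_radialCutoff hR)
  have hiB : Integrable ((closedBall (0 : E3) (R / 2)).indicator (gradSq v)) :=
    (integrableOn_gradSq_closedBall hv _).integrable_indicator measurableSet_closedBall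
  have hiA : Integrable ((ann R).indicator (gradSq v)) :=
    ((integrableOn_gradSq_closedBall hv R).mono_set
      (ann_subset_closedBall R)).integrable_indicator (measurableSet_ann R)
  have h := integral_mono (hiB.sub (hiA.const_mul (8 / 3 * K))) hi
    (stress_integrand_lower_bound hK hR v)
  rw [h0, integral_sub' hiB (hiA.const_mul _), integral_const_mul,
    integral_indicator measurableSet_closedBall, integral_indicator (measurableSet_ann R)] at h
  linarith

theorem ball_energy_add_annulus_energy_le (hv : ContDiff ℝ (⊤ : ℕ∞) v) {R : ℝ} (hR : 0 < R) :
    (∫ x in closedBall 0 (R / 2), gradSq v x) + ∫ x in ann R, gradSq v x ≤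
      ∫ x in closedBall 0 R, gradSq v x := by
  have hdisj : Disjoint (closedBall (0 : E3) (R / 2)) (ann R) :=
    Set.disjoint_left.2 fun x hx hA => absurd hA.1 (mem_closedBall_zero_iff.1 hx).not_gt
  have hsub : closedBall (0 : E3) (R / 2) ⊆ closedBall 0 R :=
    closedBall_subset_closedBall (by linarith)
  have hi := integrableOn_gradSq_closedBall hv R
  rw [← setIntegral_union hdisj (measurableSet_ann R) (hi.mono_set hsub)
    (hi.mono_set (ann_subset_closedBall R))]
  exact setIntegral_mono_set hi (Eventually.of_forall (gradSq_nonneg v))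
    (Set.union_subset hsub (ann_subset_closedBall R)).eventuallyLE

end Monotonicity

/-- A bounded function on `[1, ∞)` that grows by a fixed factor under doubling
vanishes. -/
theorem eq_zero_of_doubling_growth {E : ℝ → ℝ} {q M r : ℝ} (hq : 1 < q) (hr : 1 ≤ r)
    (h0 : 0 ≤ E r) (hM : ∀ s, 1 ≤ s → E s ≤ M) (hE : ∀ s, 1 ≤ s → q * E s ≤ E (2 * s)) :
    E r = 0 := by
  by_contra hne
  have hpos : 0 < E r := lt_of_le_of_ne h0 (Ne.symm hne)
  have hgrow (n : ℕ) : q ^ n * E r ≤ E (2 ^ n * r) := by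
    induction n with
    | zero => simp
    | succ n ih =>
      have h1 : 1 ≤ 2 ^ n * r := one_le_mul_of_one_le_of_one_le (one_le_pow₀ one_le_two) hr
      calc q ^ (n + 1) * E r = q * (q ^ n * E r) := by ring
        _ ≤ q * E (2 ^ n * r) := by gcongr
        _ ≤ E (2 * (2 ^ n * r)) := hE _ h1
        _ = E (2 ^ (n + 1) * r) := by ring_nf
  obtain ⟨n, hn⟩ := pow_unbounded_of_one_lt (M / E r) hq
  rw [div_lt_iff₀ hpos] at hn
  exact absurd ((hgrow n).trans
    (hM _ (one_le_mul_of_one_le_of_one_le (one_le_pow₀ one_le_two) hr))) hn.not_ge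

theorem harmonic_map_liouville
    (v : E3 → Fin 3 → ℝ) (hv : ContDiff ℝ (⊤ : ℕ∞) v)
    (hunit : ∀ x : E3, ∑ i, (v x i) ^ 2 = 1)
    (heq : ∀ x : E3, ∀ i : Fin 3,
      -(lap (fun y => v y i) x) - gradSq v x * v x i = 0)
    (hbound : ∃ C : ℝ, ∀ R : ℝ, 1 ≤ R → ∫ x in ann R, gradSq v x ≤ C) :
    ∀ x : E3, ∀ i k : Fin 3, pd i (fun y => v y k) x = 0 := by
  obtain ⟨C, hC⟩ := hbound
  obtain ⟨c, hc, hle⟩ := exists_ball_energy_le_annulus_energy hv hunit heq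
  have hzero (r : ℝ) (hr : 1 ≤ r) : ∫ x in closedBall 0 r, gradSq v x = 0 := by
    refine eq_zero_of_doubling_growth (E := fun s => ∫ x in closedBall 0 s, gradSq v x)
      (q := 1 + 1 / c) (M := c * C) (by simpa using hc) hr
      (integral_nonneg (gradSq_nonneg v)) (fun s hs => ?_) fun s hs => ?_
    · have h := hle (2 * s) (by linarith)
      rw [mul_div_cancel_left₀ s two_ne_zero] at h
      exact h.trans (mul_le_mul_of_nonneg_left (hC _ (by linarith)) hc.le)
    · have h := hle (2 * s) (by linarith)
      have h' := ball_energy_add_annulus_energy_le hv (R := 2 * s) (by linarith)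
      rw [mul_div_cancel_left₀ s two_ne_zero] at h h'
      rw [mul_comm c, ← div_le_iff₀ hc] at h
      calc (1 + 1 / c) * ∫ x in closedBall 0 s, gradSq v x
          = (∫ x in closedBall 0 s, gradSq v x) + (∫ x in closedBall 0 s, gradSq v x) / c := by
            ring
        _ ≤ _ := by linarith
  intro x i k
  have hae : gradSq v =ᵐ[volume.restrict (closedBall 0 (‖x‖ + 1))] 0 :=
    (setIntegral_eq_zero_iff_of_nonneg_ae (Eventually.of_forall (gradSq_nonneg v))
      (integrableOn_gradSq_closedBall hv _)).1 (hzero _ (by linarith [norm_nonneg x]))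
  have hx : gradSq v x = 0 :=
    Measure.eqOn_open_of_ae_eq (ae_restrict_of_ae_restrict_of_subset ball_subset_closedBall hae)
      isOpen_ball (contDiff_gradSq hv).continuous.continuousOn continuousOn_const
      (mem_ball_zero_iff.2 (lt_add_one ‖x‖))
  unfold gradSq at hx
  rw [Finset.sum_eq_zero_iff_of_nonneg fun _ _ => by positivity] at hx
  have hi := hx i (Finset.mem_univ i)
  rw [Finset.sum_eq_zero_iff_of_nonneg fun _ _ => by positivity] at hi
  exact pow_eq_zero_iff two_ne_zero |>.1 (hi k (Finset.mem_univ k))
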